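/- (Convergence of RSD, convex case.) Under the setting of the RSD algorithm — A x^0 = b, M symmetric positive semidefinite and positive definite on ker(A), f differentiable and convex with f(y) ≤ f(x) + ⟨∇f(x), y−x⟩ + ½(y−x)^T M(y−x) for x, y ∈ x^0 + ker(A), S^k i.i.d. from a finite distribution with Z = Σ_i P_i Z_{S_i} positive definite on ker(A), x^{k+1} = x^k − Z_{S^k} ∇f(x^k) — let f* be the minimum of f over {x : Ax = b}, X* the set of minimizers, and suppose R(x^0) := max{ min_{x* ∈ X*} √((x−x*)^T Z† (x−x*)) : x ∈ x^0 + ker(A), f(x) ≤ f(x^0) } is finite. Then for every k ≥ 1 the expected objective value φ_k = E[f(x^k)] satisfies φ_k − f* ≤ 2 R(x^0)^2 / ( k + 2 R(x^0)^2/(f(x^0) − f*) ). -/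

import Mathlib

open Matrix

-- The Moore–Penrose pseudoinverse of a real matrix, defined via the four
-- Penrose conditions (which have a unique solution for every real matrix).
open Classical in
noncomputable def mpinv {k l : Type*} [Fintype k] [Fintype l] (B : Matrix k l ℝ) :
    Matrix l k ℝ :=
  if h : ∃ X : Matrix l k ℝ,
      B * X * B = B ∧ X * B * X = X ∧ (B * X)ᵀ = B * X ∧ (X * B)ᵀ = X * B
  then h.choose else 0

/-- `P_S = I - (AS)†(AS)`, the orthogonal projection onto `ker(AS)`. -/
noncomputable def Pmat {m n p : ℕ} (A : Matrix (Fin m) (Fin n) ℝ)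
    (S : Matrix (Fin n) (Fin p) ℝ) : Matrix (Fin p) (Fin p) ℝ :=
  1 - mpinv (A * S) * (A * S)

/-- `Z_S = S P_S (P_Sᵀ Sᵀ M S P_S)† P_Sᵀ Sᵀ`. -/
noncomputable def Zmat {m n p : ℕ} (A : Matrix (Fin m) (Fin n) ℝ)
    (M : Matrix (Fin n) (Fin n) ℝ) (S : Matrix (Fin n) (Fin p) ℝ) :
    Matrix (Fin n) (Fin n) ℝ :=
  S * Pmat A S * mpinv ((Pmat A S)ᵀ * Sᵀ * M * S * Pmat A S) * (Pmat A S)ᵀ * Sᵀ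

/-- The gradient of `f : ℝ^n → ℝ`, as a vector of partial derivatives. -/
noncomputable def gradv {n : ℕ} (f : (Fin n → ℝ) → ℝ) (x : Fin n → ℝ) : Fin n → ℝ :=
  fun i => fderiv ℝ f x (Pi.single i 1)

/-- The four Penrose conditions. -/
def IsMoorePenrose {k l : Type*} [Fintype k] [Fintype l] (B : Matrix k l ℝ)
    (X : Matrix l k ℝ) : Prop :=
  B * X * B = B ∧ X * B * X = X ∧ (B * X)ᵀ = B * X ∧ (X * B)ᵀ = X * B

namespace IsMoorePenrose

variable {k l : Type*} [Fintype k] [Fintype l] {B : Matrix k l ℝ} {X Y : Matrix l k ℝ}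

theorem unique (hX : IsMoorePenrose B X) (hY : IsMoorePenrose B Y) : X = Y := by
  obtain ⟨hX1, hX2, hX3, hX4⟩ := hX
  obtain ⟨hY1, hY2, hY3, hY4⟩ := hY
  have hl : B * X = B * Y := by
    calc B * X = (B * X)ᵀ := hX3.symm
      _ = (B * Y * (B * X))ᵀ := by rw [← Matrix.mul_assoc, hY1]
      _ = B * X * (B * Y) := by rw [transpose_mul, hX3, hY3]
      _ = B * Y := by rw [← Matrix.mul_assoc, hX1]
  have hr : X * B = Y * B := by
    calc X * B = (X * B)ᵀ := hX4.symm
      _ = (X * B * (Y * B))ᵀ := by rw [Matrix.mul_assoc X, ← Matrix.mul_assoc B, hY1]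
      _ = Y * B * (X * B) := by rw [transpose_mul, hX4, hY4]
      _ = Y * B := by rw [Matrix.mul_assoc Y, ← Matrix.mul_assoc B, hX1]
  calc X = X * B * X := hX2.symm
    _ = Y * B * Y := by rw [Matrix.mul_assoc, hl, ← Matrix.mul_assoc, hr]
    _ = Y := hY2

theorem transpose (hX : IsMoorePenrose B X) : IsMoorePenrose Bᵀ Xᵀ := by
  obtain ⟨h1, h2, h3, h4⟩ := hX
  refine ⟨?_, ?_, ?_, ?_⟩
  · rw [← transpose_mul, ← transpose_mul, ← Matrix.mul_assoc, h1]
  · rw [← transpose_mul, ← transpose_mul, ← Matrix.mul_assoc, h2]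
  · rw [← transpose_mul, h4, h4]
  · rw [← transpose_mul, h3, h3]

theorem exists_of_isSymm [DecidableEq k] {C : Matrix k k ℝ} (hC : C.IsSymm) :
    ∃ X, IsMoorePenrose C X := by
  have hH : C.IsHermitian := by
    rw [IsHermitian, conjTranspose_eq_transpose_of_trivial]; exact hC
  obtain ⟨U, d, hU, hCU⟩ : ∃ (U : Matrix k k ℝ) (d : k → ℝ),
      Uᵀ * U = 1 ∧ C = U * diagonal d * Uᵀ := by
    refine ⟨hH.eigenvectorUnitary, hH.eigenvalues, ?_, ?_⟩
    · have := Unitary.coe_star_mul_self hH.eigenvectorUnitary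
      rwa [star_eq_conjTranspose, conjTranspose_eq_transpose_of_trivial] at this
    · have := hH.spectral_theorem
      rwa [Unitary.conjStarAlgAut_apply, star_eq_conjTranspose,
        conjTranspose_eq_transpose_of_trivial] at this
  have key (a b : k → ℝ) : U * diagonal a * Uᵀ * (U * diagonal b * Uᵀ) =
      U * diagonal (fun i => a i * b i) * Uᵀ := by
    calc _ = U * diagonal a * (Uᵀ * U) * diagonal b * Uᵀ := by simp only [Matrix.mul_assoc]
      _ = _ := by rw [hU, Matrix.mul_one, Matrix.mul_assoc U, diagonal_mul_diagonal]
  have hs (a : k → ℝ) : (U * diagonal a * Uᵀ)ᵀ = U * diagonal a * Uᵀ := by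
    simp [transpose_mul, Matrix.mul_assoc]
  refine ⟨U * diagonal (fun i => (d i)⁻¹) * Uᵀ, ?_⟩
  rw [hCU]
  refine ⟨?_, ?_, ?_, ?_⟩
  · simp [key]
  · have h (i : k) : (d i)⁻¹ * d i * (d i)⁻¹ = (d i)⁻¹ := by
      by_cases hi : d i = 0 <;> simp [hi]
    simp only [key, h]
  · rw [key, hs]
  · rw [key, hs]

theorem exists_inverse (B : Matrix k l ℝ) : ∃ X, IsMoorePenrose B X := by
  classical
  have hsymm : (Bᵀ * B)ᵀ = Bᵀ * B := by simp
  obtain ⟨G, hG⟩ := exists_of_isSymm hsymm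
  have hGs : Gᵀ = G := (hsymm ▸ hG.transpose).unique hG
  obtain ⟨h1, h2, h3, h4⟩ := hG
  refine ⟨G * Bᵀ, ?_, ?_, ?_, ?_⟩
  · have h0 : Bᴴ * B * (G * (Bᵀ * B) - 1) = 0 := by
      rw [conjTranspose_eq_transpose_of_trivial, Matrix.mul_sub, Matrix.mul_one,
        ← Matrix.mul_assoc, h1, sub_self]
    rw [conjTranspose_mul_self_mul_eq_zero, Matrix.mul_sub, Matrix.mul_one, sub_eq_zero] at h0
    simpa only [Matrix.mul_assoc] using h0
  · calc G * Bᵀ * B * (G * Bᵀ) = G * (Bᵀ * B) * G * Bᵀ := by simp only [Matrix.mul_assoc]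
      _ = G * Bᵀ := by rw [h2]
  · simp [transpose_mul, hGs, Matrix.mul_assoc]
  · rw [Matrix.mul_assoc, h4]

end IsMoorePenrose

theorem isMoorePenrose_mpinv {k l : Type*} [Fintype k] [Fintype l] (B : Matrix k l ℝ) :
    IsMoorePenrose B (mpinv B) := by
  have h := IsMoorePenrose.exists_inverse B
  unfold IsMoorePenrose at h
  unfold mpinv IsMoorePenrose
  rw [dif_pos h]
  exact h.choose_spec

theorem mpinv_transpose_of_isSymm {k : Type*} [Fintype k] {C : Matrix k k ℝ} (hC : Cᵀ = C) :
    (mpinv C)ᵀ = mpinv C := by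
  have h := (isMoorePenrose_mpinv C).transpose
  rw [hC] at h
  exact h.unique (isMoorePenrose_mpinv C)

section Zmat

variable {m n p : ℕ} (A : Matrix (Fin m) (Fin n) ℝ) {M : Matrix (Fin n) (Fin n) ℝ}
  (S : Matrix (Fin n) (Fin p) ℝ)

theorem mul_Zmat : A * Zmat A M S = 0 := by
  have h : A * S * Pmat A S = 0 := by
    rw [Pmat, Matrix.mul_sub, Matrix.mul_one, ← Matrix.mul_assoc,
      (isMoorePenrose_mpinv (A * S)).1, sub_self]
  simp only [Zmat, ← Matrix.mul_assoc, h, Matrix.zero_mul]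

theorem transpose_Zmat (hM : Mᵀ = M) : (Zmat A M S)ᵀ = Zmat A M S := by
  have h := mpinv_transpose_of_isSymm (C := (Pmat A S)ᵀ * Sᵀ * M * S * Pmat A S)
    (by simp [transpose_mul, hM, Matrix.mul_assoc])
  rw [Zmat]
  generalize mpinv ((Pmat A S)ᵀ * Sᵀ * M * S * Pmat A S) = K at h ⊢
  simp only [transpose_mul, transpose_transpose, h, Matrix.mul_assoc]

theorem Zmat_mul_mul_Zmat : Zmat A M S * M * Zmat A M S = Zmat A M S := by
  have h := (isMoorePenrose_mpinv ((Pmat A S)ᵀ * Sᵀ * M * S * Pmat A S)).2.1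
  calc Zmat A M S * M * Zmat A M S
      = S * Pmat A S * (mpinv ((Pmat A S)ᵀ * Sᵀ * M * S * Pmat A S) *
          ((Pmat A S)ᵀ * Sᵀ * M * S * Pmat A S) *
          mpinv ((Pmat A S)ᵀ * Sᵀ * M * S * Pmat A S)) * (Pmat A S)ᵀ * Sᵀ := by
        simp only [Zmat, Matrix.mul_assoc]
    _ = Zmat A M S := by rw [h, Zmat]

theorem dotProduct_Zmat_mulVec (hM : Mᵀ = M) (g : Fin n → ℝ) :
    Zmat A M S *ᵥ g ⬝ᵥ M *ᵥ (Zmat A M S *ᵥ g) = g ⬝ᵥ Zmat A M S *ᵥ g := by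
  conv_rhs => rw [← Zmat_mul_mul_Zmat]
  rw [← mulVec_mulVec, ← mulVec_mulVec, dotProduct_mulVec g, ← mulVec_transpose,
    transpose_Zmat A S hM]

theorem dotProduct_Zmat_mulVec_nonneg (hM : M.PosSemidef) (g : Fin n → ℝ) :
    0 ≤ g ⬝ᵥ Zmat A M S *ᵥ g := by
  have hMs : Mᵀ = M := by
    simpa [IsHermitian, conjTranspose_eq_transpose_of_trivial] using hM.isHermitian
  rw [← dotProduct_Zmat_mulVec A S hMs]
  simpa using hM.dotProduct_mulVec_nonneg (Zmat A M S *ᵥ g)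

end Zmat

theorem sq_dotProduct_mulVec_le {ι : Type*} [Fintype ι] {Z : Matrix ι ι ℝ} (hZs : Zᵀ = Z)
    (hZ : ∀ v, 0 ≤ v ⬝ᵥ Z *ᵥ v) (g w : ι → ℝ) :
    (g ⬝ᵥ Z *ᵥ w) ^ 2 ≤ (g ⬝ᵥ Z *ᵥ g) * (w ⬝ᵥ Z *ᵥ w) := by
  have hcomm : w ⬝ᵥ Z *ᵥ g = g ⬝ᵥ Z *ᵥ w := by
    rw [dotProduct_mulVec, ← mulVec_transpose, hZs, dotProduct_comm]
  have h (t : ℝ) :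
      0 ≤ (w ⬝ᵥ Z *ᵥ w) * (t * t) + (2 * (g ⬝ᵥ Z *ᵥ w)) * t + g ⬝ᵥ Z *ᵥ g := by
    have := hZ (g + t • w)
    simp only [mulVec_add, mulVec_smul, add_dotProduct, dotProduct_add, smul_dotProduct,
      dotProduct_smul, smul_eq_mul, hcomm] at this
    linarith
  have := discrim_le_zero h
  rw [discrim] at this
  linarith

/-- If `Z` is symmetric, maps into `ker A` and is positive definite on `ker A`, then `Z * Z†` is the
identity on `ker A`. -/
theorem mulVec_mpinv_mulVec {ι κ : Type*} [Fintype ι] [Fintype κ] {A : Matrix κ ι ℝ}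
    {Z : Matrix ι ι ℝ} (hZs : Zᵀ = Z) (hAZ : A * Z = 0)
    (hpd : ∀ u : ι → ℝ, A *ᵥ u = 0 → u ≠ 0 → 0 < u ⬝ᵥ Z *ᵥ u)
    {u : ι → ℝ} (hu : A *ᵥ u = 0) : Z *ᵥ (mpinv Z *ᵥ u) = u := by
  obtain ⟨h1, -, h3, -⟩ := isMoorePenrose_mpinv Z
  have hcomm : Z * mpinv Z = mpinv Z * Z := by
    rw [← h3, transpose_mul, hZs, mpinv_transpose_of_isSymm hZs]
  by_contra hne
  have hA : A *ᵥ (u - Z *ᵥ (mpinv Z *ᵥ u)) = 0 := by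
    rw [mulVec_sub, hu, mulVec_mulVec, hAZ, zero_mulVec, sub_zero]
  have h := hpd _ hA (sub_ne_zero.mpr (Ne.symm hne))
  have hz : Z *ᵥ (u - Z *ᵥ (mpinv Z *ᵥ u)) = 0 := by
    rw [mulVec_sub, mulVec_mulVec u, hcomm, mulVec_mulVec, ← Matrix.mul_assoc, h1, sub_self]
  rw [hz, dotProduct_zero] at h
  exact lt_irrefl _ h

theorem sq_dotProduct_le_of_mulVec_eq_zero {ι κ : Type*} [Fintype ι] [Fintype κ]
    {A : Matrix κ ι ℝ} {Z : Matrix ι ι ℝ} (hZs : Zᵀ = Z) (hZ : ∀ v, 0 ≤ v ⬝ᵥ Z *ᵥ v)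
    (hAZ : A * Z = 0) (hpd : ∀ u : ι → ℝ, A *ᵥ u = 0 → u ≠ 0 → 0 < u ⬝ᵥ Z *ᵥ u)
    {u : ι → ℝ} (hu : A *ᵥ u = 0) (g : ι → ℝ) :
    (g ⬝ᵥ u) ^ 2 ≤ (g ⬝ᵥ Z *ᵥ g) * (u ⬝ᵥ mpinv Z *ᵥ u) := by
  have h := sq_dotProduct_mulVec_le hZs hZ g (mpinv Z *ᵥ u)
  rwa [mulVec_mpinv_mulVec hZs hAZ hpd hu, dotProduct_comm (mpinv Z *ᵥ u)] at h

theorem gradv_dotProduct {n : ℕ} (f : (Fin n → ℝ) → ℝ) (x v : Fin n → ℝ) :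
    gradv f x ⬝ᵥ v = fderiv ℝ f x v := by
  have h := LinearMap.pi_apply_eq_sum_univ (fderiv ℝ f x).toLinearMap v
  simp only [ContinuousLinearMap.coe_coe, smul_eq_mul] at h
  rw [h, dotProduct]
  refine Finset.sum_congr rfl fun i _ => ?_
  rw [mul_comm, gradv]
  congr 2
  ext j
  simp [Pi.single_apply, eq_comm]

theorem ConvexOn.add_fderiv_le {E : Type*} [NormedAddCommGroup E] [NormedSpace ℝ E] {f : E → ℝ}
    (hf : ConvexOn ℝ Set.univ f) {x : E} (hd : DifferentiableAt ℝ f x) (y : E) :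
    f x + fderiv ℝ f x (y - x) ≤ f y := by
  have hg : ConvexOn ℝ Set.univ (f ∘ AffineMap.lineMap (k := ℝ) x y) := by
    simpa using hf.comp_affineMap (AffineMap.lineMap (k := ℝ) x y)
  have hl : HasDerivAt (AffineMap.lineMap (k := ℝ) x y) (y - x) 0 :=
    AffineMap.hasDerivAt_lineMap
  have hD : HasDerivAt (f ∘ AffineMap.lineMap (k := ℝ) x y) (fderiv ℝ f x (y - x)) 0 := by
    refine HasFDerivAt.comp_hasDerivAt _ ?_ hl
    simpa using hd.hasFDerivAt
  have h := hg.le_slope_of_hasDerivAt (Set.mem_univ 0) (Set.mem_univ 1) one_pos hD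
  simp only [slope, sub_zero, inv_one, vsub_eq_sub, Function.comp_apply,
    AffineMap.lineMap_apply_one, AffineMap.lineMap_apply_zero, one_smul] at h
  linarith

/-- Expectation of `h` over `k` i.i.d. samples with weights `P`. -/
noncomputable def iidExp {ι : Type*} [Fintype ι] (P : ι → ℝ) (k : ℕ) (h : (Fin k → ι) → ℝ) : ℝ :=
  ∑ ω : Fin k → ι, (∏ j, P (ω j)) * h ω

section iidExp

variable {ι : Type*} [Fintype ι] {P : ι → ℝ}

theorem iidExp_succ (k : ℕ) (h : (Fin (k + 1) → ι) → ℝ) :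
    iidExp P (k + 1) h = iidExp P k fun ω => ∑ i, P i * h (Fin.snoc ω i) := by
  simp only [iidExp, Finset.mul_sum]
  rw [← (Fin.snocEquiv fun _ => ι).sum_comp, Fintype.sum_prod_type_right]
  refine Finset.sum_congr rfl fun ω _ => Finset.sum_congr rfl fun i _ => ?_
  simp [Fin.snocEquiv, Fin.prod_univ_castSucc, mul_assoc]

theorem iidExp_mono (hP : ∀ i, 0 ≤ P i) {k : ℕ} {h h' : (Fin k → ι) → ℝ}
    (hh : ∀ ω, h ω ≤ h' ω) : iidExp P k h ≤ iidExp P k h' :=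
  Finset.sum_le_sum fun ω _ =>
    mul_le_mul_of_nonneg_left (hh ω) (Finset.prod_nonneg fun _ _ => hP _)

theorem iidExp_const (hP : ∑ i, P i = 1) (k : ℕ) (c : ℝ) : iidExp P k (fun _ => c) = c := by
  induction k with
  | zero => simp [iidExp]
  | succ k ih => rw [iidExp_succ, ← Finset.sum_mul, hP, one_mul, ih]

theorem iidExp_mul_add (hP : ∑ i, P i = 1) (k : ℕ) (a c : ℝ) (h : (Fin k → ι) → ℝ) :
    iidExp P k (fun ω => a * h ω + c) = a * iidExp P k h + c := by
  conv_rhs => rw [← iidExp_const hP k c]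
  simp only [iidExp, Finset.mul_sum, ← Finset.sum_add_distrib]
  exact Finset.sum_congr rfl fun ω _ => by ring

theorem iidExp_sub (k : ℕ) (h h' : (Fin k → ι) → ℝ) :
    iidExp P k (fun ω => h ω - h' ω) = iidExp P k h - iidExp P k h' := by
  simp only [iidExp, mul_sub, Finset.sum_sub_distrib]

theorem sq_iidExp_le (hP0 : ∀ i, 0 ≤ P i) (hP : ∑ i, P i = 1) (k : ℕ) (h : (Fin k → ι) → ℝ) :
    (iidExp P k h) ^ 2 ≤ iidExp P k fun ω => h ω ^ 2 := by
  have := iidExp_mono hP0 (h := fun ω => 2 * iidExp P k h * h ω + -(iidExp P k h) ^ 2)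
    (h' := fun ω => h ω ^ 2) (fun ω => by nlinarith [sq_nonneg (h ω - iidExp P k h)])
  rw [iidExp_mul_add hP] at this
  linarith

end iidExp

/-- A nonnegative sequence with `e k ^ 2 ≤ c * (e k - e (k + 1))` decays like `c / k`. -/
theorem le_div_of_sq_le_mul_sub {e : ℕ → ℝ} {c : ℝ} (he : ∀ k, 0 ≤ e k)
    (hc : 0 ≤ c) (hstep : ∀ k, e k ^ 2 ≤ c * (e k - e (k + 1))) (k : ℕ) (hk : 1 ≤ k) :
    e k ≤ c / (k + c / e 0) := by
  have hk0 : (0 : ℝ) < k := by exact_mod_cast hk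
  have hden : 0 < k + c / e 0 := by have := div_nonneg hc (he 0); linarith
  rcases hc.eq_or_lt with rfl | hc
  · have := hstep k
    rw [zero_mul] at this
    simp [pow_eq_zero_iff two_ne_zero |>.mp (le_antisymm this (sq_nonneg _))]
  have hanti : Antitone e := antitone_nat_of_succ_le fun k => by
    have : 0 ≤ c * (e k - e (k + 1)) := (sq_nonneg _).trans (hstep k)
    linarith [nonneg_of_mul_nonneg_right this hc]
  rcases (he 0).eq_or_lt with h0 | h0
  · exact ((hanti (Nat.zero_le k)).trans h0.symm.le).trans (by positivity)
  rw [le_div_iff₀ hden]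
  clear hk hk0 hden
  induction k with
  | zero => simp [mul_div_cancel₀ c h0.ne']
  | succ k ih =>
    set a := (k : ℝ) + c / e 0 with ha
    have ha0 : 0 ≤ a := by positivity
    have hec : e k ≤ c := by
      by_contra! hlt
      nlinarith [hstep k, mul_nonneg hc.le (he (k + 1)), he k]
    have h1 : e (k + 1) * (((k + 1 : ℕ) : ℝ) + c / e 0) = e (k + 1) * (a + 1) := by
      rw [ha]; push_cast; ring
    rw [h1]
    have h2 : c * e (k + 1) * (a + 1) ≤ (c * e k - e k ^ 2) * (a + 1) :=
      mul_le_mul_of_nonneg_right (by linarith [hstep k]) (by linarith)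
    have h3 : (c * e k - e k ^ 2) * (a + 1) ≤ c * c := by
      nlinarith [mul_nonneg (sub_nonneg.mpr ih) (sub_nonneg.mpr hec), sq_nonneg (e k)]
    refine le_of_mul_le_mul_left ?_ hc
    linarith

/-- sublinear convergence of RSD in the smooth convex case:
`φ_k − f* ≤ 2R(x⁰)² / (k + 2R(x⁰)²/(f(x⁰) − f*))`. -/
theorem stmt9 {m n N : ℕ} (A : Matrix (Fin m) (Fin n) ℝ) (b : Fin m → ℝ)
    (x0 : Fin n → ℝ) (hx0 : A.mulVec x0 = b)
    (M : Matrix (Fin n) (Fin n) ℝ) (hM : M.PosSemidef)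
    (hMpd : ∀ u : Fin n → ℝ, A.mulVec u = 0 → u ≠ 0 → 0 < u ⬝ᵥ M.mulVec u)
    (f : (Fin n → ℝ) → ℝ) (hdiff : Differentiable ℝ f) (hconv : ConvexOn ℝ Set.univ f)
    (hsmooth : ∀ x y : Fin n → ℝ, A.mulVec x = b → A.mulVec y = b →
      f y ≤ f x + gradv f x ⬝ᵥ (y - x) + (1 / 2) * ((y - x) ⬝ᵥ M.mulVec (y - x)))
    (p : Fin N → ℕ) (S : ∀ i : Fin N, Matrix (Fin n) (Fin (p i)) ℝ)
    (P : Fin N → ℝ) (hP : ∀ i, 0 ≤ P i) (hPsum : ∑ i, P i = 1)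
    (Z : Matrix (Fin n) (Fin n) ℝ) (hZ : Z = ∑ i, P i • Zmat A M (S i))
    (hpd : ∀ u : Fin n → ℝ, A.mulVec u = 0 → u ≠ 0 → 0 < u ⬝ᵥ Z.mulVec u)
    -- the optimal value `f*`, attained on the feasible set
    (fstar : ℝ) (hfs : ∀ x : Fin n → ℝ, A.mulVec x = b → fstar ≤ f x)
    (hfattained : ∃ xs : Fin n → ℝ, A.mulVec xs = b ∧ f xs = fstar)
    -- the RSD iterates, indexed by the history of i.i.d. sketch samples
    (X : ∀ k : ℕ, (Fin k → Fin N) → (Fin n → ℝ))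
    (hX0 : ∀ ω : Fin 0 → Fin N, X 0 ω = x0)
    (hXstep : ∀ (k : ℕ) (ω : Fin (k + 1) → Fin N),
      X (k + 1) ω = X k (fun j => ω j.castSucc) -
        (Zmat A M (S (ω (Fin.last k)))).mulVec (gradv f (X k (fun j => ω j.castSucc))))
    -- `R(x⁰)`, the (finite) radius of the initial sublevel set in the dual norm
    (Rset : Set ℝ)
    (hRset : Rset = {r : ℝ | ∃ x : Fin n → ℝ, A.mulVec x = b ∧ f x ≤ f x0 ∧
      r = sInf {d : ℝ | ∃ xs : Fin n → ℝ,
        (A.mulVec xs = b ∧ f xs = fstar) ∧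
        d = Real.sqrt ((x - xs) ⬝ᵥ (mpinv Z).mulVec (x - xs))}})
    (hRbdd : BddAbove Rset) (R : ℝ) (hR : R = sSup Rset)
    (k : ℕ) (hk : 1 ≤ k) :
    (∑ ω : Fin k → Fin N, (∏ j, P (ω j)) * f (X k ω)) - fstar ≤
      2 * R ^ 2 / (k + 2 * R ^ 2 / (f x0 - fstar)) := by
  have hMs : Mᵀ = M := by
    simpa [IsHermitian, conjTranspose_eq_transpose_of_trivial] using hM.isHermitian
  have hZg (g : Fin n → ℝ) : g ⬝ᵥ Z *ᵥ g = ∑ i, P i * (g ⬝ᵥ Zmat A M (S i) *ᵥ g) := by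
    rw [hZ, sum_mulVec, dotProduct_sum]
    simp [smul_mulVec, dotProduct_smul]
  have hZs : Zᵀ = Z := by
    rw [hZ, transpose_sum]
    simp [transpose_Zmat _ _ hMs]
  have hAZ : A * Z = 0 := by
    rw [hZ, Matrix.mul_sum]
    simp [mul_Zmat]
  have hZnn (v : Fin n → ℝ) : 0 ≤ v ⬝ᵥ Z *ᵥ v := by
    rw [hZg]
    exact Finset.sum_nonneg fun i _ =>
      mul_nonneg (hP i) (dotProduct_Zmat_mulVec_nonneg A (S i) hM v)
  have hfeas (x : Fin n → ℝ) (hx : A *ᵥ x = b) (i : Fin N) :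
      A *ᵥ (x - Zmat A M (S i) *ᵥ gradv f x) = b := by
    rw [mulVec_sub, mulVec_mulVec, mul_Zmat, zero_mulVec, sub_zero, hx]
  have hdescent (x : Fin n → ℝ) (hx : A *ᵥ x = b) (i : Fin N) :
      f (x - Zmat A M (S i) *ᵥ gradv f x) ≤
        f x - 1 / 2 * (gradv f x ⬝ᵥ Zmat A M (S i) *ᵥ gradv f x) := by
    have h := hsmooth x _ hx (hfeas x hx i)
    rw [sub_sub_cancel_left, mulVec_neg, neg_dotProduct, dotProduct_neg, dotProduct_neg, neg_neg,
      dotProduct_Zmat_mulVec A (S i) hMs] at h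
    linarith
  have hgap (x : Fin n → ℝ) (hx : A *ᵥ x = b) (hfx : f x ≤ f x0) :
      (f x - fstar) ^ 2 ≤ R ^ 2 * (gradv f x ⬝ᵥ Z *ᵥ gradv f x) := by
    have hle : f x - fstar ≤ √(gradv f x ⬝ᵥ Z *ᵥ gradv f x) * R := by
      set D : Set ℝ := {d : ℝ | ∃ xs : Fin n → ℝ, (A.mulVec xs = b ∧ f xs = fstar) ∧
        d = Real.sqrt ((x - xs) ⬝ᵥ (mpinv Z).mulVec (x - xs))} with hD
      have hDR : sInf D ≤ R := by
        rw [hR]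
        refine le_csSup hRbdd ?_
        rw [hRset]
        exact ⟨x, hx, hfx, rfl⟩
      have hDne : D.Nonempty := by
        obtain ⟨xs, h⟩ := hfattained
        exact ⟨_, xs, h, rfl⟩
      have hd : ∀ d ∈ D, f x - fstar ≤ √(gradv f x ⬝ᵥ Z *ᵥ gradv f x) * d := by
        rintro d ⟨xs, ⟨hxs, hfxs⟩, rfl⟩
        have hc := hconv.add_fderiv_le (hdiff x) xs
        have hu : A *ᵥ (x - xs) = 0 := by rw [mulVec_sub, hx, hxs, sub_self]
        rw [← gradv_dotProduct, ← neg_sub x xs, dotProduct_neg, hfxs] at hc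
        rw [← Real.sqrt_mul (hZnn _)]
        refine le_trans (by linarith) (Real.le_sqrt_of_sq_le
          (sq_dotProduct_le_of_mulVec_eq_zero hZs hZnn hAZ hpd hu (gradv f x)))
      rcases (Real.sqrt_nonneg (gradv f x ⬝ᵥ Z *ᵥ gradv f x)).eq_or_lt with h0 | h0
      · obtain ⟨d, hdD⟩ := hDne
        simpa [← h0] using hd d hdD
      · refine le_trans ?_ (mul_le_mul_of_nonneg_left hDR h0.le)
        rw [← div_le_iff₀' h0]
        exact le_csInf hDne fun d hdD => (div_le_iff₀' h0).mpr (hd d hdD)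
    have h := pow_le_pow_left₀ (sub_nonneg.mpr (hfs x hx)) hle 2
    rwa [mul_pow, Real.sq_sqrt (hZnn _), mul_comm] at h
  have hX (k : ℕ) : ∀ ω, A *ᵥ X k ω = b ∧ f (X k ω) ≤ f x0 := by
    induction k with
    | zero => intro ω; rw [hX0]; exact ⟨hx0, le_rfl⟩
    | succ k ih =>
      intro ω
      obtain ⟨h1, h2⟩ := ih fun j => ω j.castSucc
      rw [hXstep]
      refine ⟨hfeas _ h1 _, (hdescent _ h1 _).trans ?_⟩
      linarith [dotProduct_Zmat_mulVec_nonneg A (S (ω (Fin.last k))) hM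
        (gradv f (X k fun j => ω j.castSucc))]
  set e : ℕ → ℝ := fun k => iidExp P k fun ω => f (X k ω) - fstar with he
  have he_eq (k : ℕ) : e k = (∑ ω : Fin k → Fin N, (∏ j, P (ω j)) * f (X k ω)) - fstar := by
    rw [he]
    simp only [iidExp_sub, iidExp_const hPsum]
    rfl
  have he0 : e 0 = f x0 - fstar := by simp [he, iidExp, hX0]
  have hnn (k : ℕ) : 0 ≤ e k := by
    rw [← iidExp_const hPsum k 0]
    exact iidExp_mono hP fun ω => sub_nonneg.mpr (hfs _ (hX k ω).1)
  have hstep (k : ℕ) : e k ^ 2 ≤ 2 * R ^ 2 * (e k - e (k + 1)) := by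
    refine (sq_iidExp_le hP hPsum k _).trans ?_
    have hsub : 2 * R ^ 2 * (e k - e (k + 1)) = iidExp P k fun ω => 2 * R ^ 2 *
        ((f (X k ω) - fstar) - ∑ i, P i * (f (X (k + 1) (Fin.snoc ω i)) - fstar)) + 0 := by
      rw [iidExp_mul_add hPsum, iidExp_sub, add_zero]
      simp only [he, iidExp_succ]
    rw [hsub]
    refine iidExp_mono hP fun ω => (hgap _ (hX k ω).1 (hX k ω).2).trans ?_
    have hdec : ∑ i, P i * (f (X (k + 1) (Fin.snoc ω i)) - fstar) ≤
        (f (X k ω) - fstar) - 1 / 2 * (gradv f (X k ω) ⬝ᵥ Z *ᵥ gradv f (X k ω)) := by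
      calc ∑ i, P i * (f (X (k + 1) (Fin.snoc ω i)) - fstar)
          ≤ ∑ i, P i * ((f (X k ω) - fstar) -
              1 / 2 * (gradv f (X k ω) ⬝ᵥ Zmat A M (S i) *ᵥ gradv f (X k ω))) := by
            refine Finset.sum_le_sum fun i _ => mul_le_mul_of_nonneg_left ?_ (hP i)
            have hnext : X (k + 1) (Fin.snoc ω i) =
                X k ω - Zmat A M (S i) *ᵥ gradv f (X k ω) := by
              have h := hXstep k (Fin.snoc ω i)
              have hinit : (fun j : Fin k => (Fin.snoc ω i : Fin (k + 1) → Fin N) j.castSucc) = ω :=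
                funext fun j => by simp
              have hlast : (Fin.snoc ω i : Fin (k + 1) → Fin N) (Fin.last k) = i := by simp
              rwa [hinit, hlast] at h
            rw [hnext]
            linarith [hdescent _ (hX k ω).1 i]
        _ = _ := by
            rw [hZg, Finset.mul_sum]
            simp only [mul_sub, Finset.sum_sub_distrib, ← Finset.sum_mul, hPsum, one_mul]
            congr 1
            exact Finset.sum_congr rfl fun i _ => by ring
    nlinarith [mul_le_mul_of_nonneg_left hdec (sq_nonneg R)]
  rw [← he_eq, ← he0]
  exact le_div_of_sq_le_mul_sub hnn (by positivity) hstep k hk
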